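/- Let G be an MN3P5 graph that has a dominating clique {a,b,c} of size 3, and suppose there is a vertex v not in {a,b,c} that is adjacent to at least two of the vertices a,b,c. Then G is isomorphic to one of the six graphs K4, W5, S1, S2, T, B (the members of the family 𝔊). -/

import Mathlib

open SimpleGraph

/-- Build a simple graph on `Fin n` from a list of edges (symmetrized, loops removed). -/
def graphOfList {n : ℕ} (l : List (Fin n × Fin n)) : SimpleGraph (Fin n) :=
  SimpleGraph.fromRel (fun a b => (a, b) ∈ l)

/-- `K4`: the complete graph on four vertices. -/
def graphK4 : SimpleGraph (Fin 4) := ⊤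

/-- `W5`: a 5-cycle `0,1,2,3,4` plus a hub `5` adjacent to all cycle vertices. -/
def graphW5 : SimpleGraph (Fin 6) :=
  graphOfList [(0,1),(1,2),(2,3),(3,4),(4,0),(5,0),(5,1),(5,2),(5,3),(5,4)]

/-- `S1`: 5-cycle `v1..v5 = 0..4`, `u2 = 5` adjacent exactly to `v1,v2,v3`,
`u5 = 6` adjacent exactly to `v1,v4,v5`. -/
def graphS1 : SimpleGraph (Fin 7) :=
  graphOfList [(0,1),(1,2),(2,3),(3,4),(4,0),(5,0),(5,1),(5,2),(6,0),(6,3),(6,4)]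

/-- `S2`: 5-cycle `v1..v5 = 0..4`, `w = 5` adjacent exactly to `v2,v3,v4,v5`,
`x = 6` adjacent exactly to `v1,v3,v4`. -/
def graphS2 : SimpleGraph (Fin 7) :=
  graphOfList [(0,1),(1,2),(2,3),(3,4),(4,0),(5,1),(5,2),(5,3),(5,4),(6,0),(6,2),(6,3)]

/-- `T`: vertices `u1,uA,uB,u2 = 0,1,2,3`, `w1,wA,wB,w2 = 4,5,6,7`, `x1,x2 = 8,9`. -/
def graphT : SimpleGraph (Fin 10) :=
  graphOfList [(0,1),(0,2),(1,2),(1,3),(2,3),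
               (4,5),(4,6),(5,6),(5,7),(6,7),
               (0,4),(0,7),(3,4),(3,7),(1,5),(2,6),
               (8,0),(8,2),(8,4),(8,5),(8,9),
               (9,1),(9,3),(9,6),(9,7)]

/-- `B`: vertices `w = 0`, `u0..u5 = 1..6`, `v0..v5 = 7..12`, with its 39 edges. -/
def graphB : SimpleGraph (Fin 13) :=
  graphOfList [(0,2),(0,3),(0,6),(0,8),(0,9),(0,12),
               (1,2),(1,3),(1,4),(1,6),(1,8),(1,12),
               (2,3),(2,4),(2,5),(2,7),
               (3,9),(3,10),(3,11),
               (4,6),(4,9),(4,10),(4,11),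
               (5,6),(5,9),(5,10),(5,11),(5,12),
               (6,7),(6,11),
               (7,8),(7,9),(7,10),(7,12),
               (8,9),(8,10),(8,11),
               (10,12),(11,12)]

/-- `G` contains an induced copy of the path `P5` on five vertices. -/
def HasInducedP5 {V : Type*} (G : SimpleGraph V) : Prop :=
  ∃ f : Fin 5 ↪ V, ∀ a b : Fin 5, (SimpleGraph.pathGraph 5).Adj a b ↔ G.Adj (f a) (f b)

/-- `G` is `P5`-free: it has no induced subgraph isomorphic to `P5`. -/
def P5Free {V : Type*} (G : SimpleGraph V) : Prop := ¬ HasInducedP5 G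

/-- `G` is an MN3P5 graph: `P5`-free, not 3-colorable, and every proper subgraph
is 3-colorable or contains an induced `P5`. -/
def IsMN3P5 {V : Type*} (G : SimpleGraph V) : Prop :=
  P5Free G ∧ ¬ G.Colorable 3 ∧
  ∀ H : G.Subgraph, H ≠ ⊤ → (H.coe.Colorable 3 ∨ HasInducedP5 H.coe)

/-- `G` is isomorphic to one of the six graphs `K4, W5, S1, S2, T, B`. -/
def IsoToSix {V : Type*} (G : SimpleGraph V) : Prop :=
  Nonempty (G ≃g graphK4) ∨ Nonempty (G ≃g graphW5) ∨ Nonempty (G ≃g graphS1) ∨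
  Nonempty (G ≃g graphS2) ∨ Nonempty (G ≃g graphT) ∨ Nonempty (G ≃g graphB)

/-- `v` traces a 5-hole (an induced 5-cycle) in `G`. -/
def IsFiveHole {V : Type*} (G : SimpleGraph V) (v : Fin 5 → V) : Prop :=
  Function.Injective v ∧ ∀ i j : Fin 5, G.Adj (v i) (v j) ↔ (j = i + 1 ∨ i = j + 1)

/-- `{a, b, c}` is a dominating clique of size 3 in `G`. -/
def IsDomClique3 {V : Type*} (G : SimpleGraph V) (a b c : V) : Prop :=
  a ≠ b ∧ a ≠ c ∧ b ≠ c ∧ G.Adj a b ∧ G.Adj a c ∧ G.Adj b c ∧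
  ∀ x : V, x ≠ a → x ≠ b → x ≠ c → (G.Adj x a ∨ G.Adj x b ∨ G.Adj x c)

/-- `H` is a subgraph of `G` (deleting vertices and edges): there is an injection of
vertices carrying edges to edges. -/
def ContainsSub {V W : Type*} (G : SimpleGraph V) (H : SimpleGraph W) : Prop :=
  ∃ f : W ↪ V, ∀ a b : W, H.Adj a b → G.Adj (f a) (f b)

/-- `G` is minimally non-`k`-colorable: not `k`-colorable, but every proper subgraph is. -/
def MinNonColorable {V : Type*} (k : ℕ) (G : SimpleGraph V) : Prop :=
  ¬ G.Colorable k ∧ ∀ H : G.Subgraph, H ≠ ⊤ → H.coe.Colorable k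


section Criticality

variable {V W : Type*} {G : SimpleGraph V} {H : SimpleGraph W}

/-- Five vertices with the adjacencies of a path form an induced `P5`. -/
theorem HasInducedP5.of_adj {v₀ v₁ v₂ v₃ v₄ : V}
    (h₀₁ : G.Adj v₀ v₁) (h₁₂ : G.Adj v₁ v₂) (h₂₃ : G.Adj v₂ v₃) (h₃₄ : G.Adj v₃ v₄)
    (h₀₂ : ¬ G.Adj v₀ v₂) (h₀₃ : ¬ G.Adj v₀ v₃) (h₀₄ : ¬ G.Adj v₀ v₄)
    (h₁₃ : ¬ G.Adj v₁ v₃) (h₁₄ : ¬ G.Adj v₁ v₄) (h₂₄ : ¬ G.Adj v₂ v₄) :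
    HasInducedP5 G := by
  have hadj : ∀ i j : Fin 5, (pathGraph 5).Adj i j ↔
      G.Adj (![v₀, v₁, v₂, v₃, v₄] i) (![v₀, v₁, v₂, v₃, v₄] j) := by
    intro i j
    fin_cases i <;> fin_cases j <;> simp [pathGraph_adj, G.adj_comm, *]
  refine ⟨⟨![v₀, v₁, v₂, v₃, v₄], fun i j hij => ?_⟩, hadj⟩
  have hnbr : ∀ k, (pathGraph 5).Adj i k ↔ (pathGraph 5).Adj j k := fun k => by
    rw [hadj, hadj, hij]
  simp only [pathGraph_adj] at hnbr
  have hinj : ∀ i j : Fin 5, (∀ k : Fin 5, (i.val + 1 = k.val ∨ k.val + 1 = i.val) ↔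
      (j.val + 1 = k.val ∨ k.val + 1 = j.val)) → i = j := by decide
  exact hinj i j hnbr

theorem HasInducedP5.map_embedding (f : H ↪g G) (h : HasInducedP5 H) : HasInducedP5 G := by
  obtain ⟨g, hg⟩ := h
  exact ⟨g.trans f.toEmbedding, fun i j => (hg i j).trans f.map_adj_iff.symm⟩

/-- In an MN3P5 graph no neighborhood contains the neighborhood of another vertex. -/
theorem IsMN3P5.exists_adj_not_adj (hG : IsMN3P5 G) {u w : V} (huw : u ≠ w) :
    ∃ x, G.Adj x u ∧ ¬ G.Adj x w := by
  classical
  by_contra! hdom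
  let S : G.Subgraph := (⊤ : G.Subgraph).induce {u}ᶜ
  have hS : S ≠ ⊤ := fun h => by
    have : u ∈ S.verts := by rw [h]; trivial
    exact this rfl
  rcases hG.2.2 S hS with hcol | hP5
  · obtain ⟨C⟩ := hcol
    refine hG.2.1 ⟨Coloring.mk
      (fun x => if h : x = u then C ⟨w, huw.symm⟩ else C ⟨x, h⟩) fun {x y} hxy => ?_⟩
    have hval : ∀ (p q : V) (hp : p ≠ u) (hq : q ≠ u), G.Adj p q → C ⟨p, hp⟩ ≠ C ⟨q, hq⟩ :=
      fun p q hp hq hpq => C.valid (show S.Adj p q from ⟨hp, hq, hpq⟩)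
    by_cases hx : x = u <;> by_cases hy : y = u
    · exact (hxy.ne (hx.trans hy.symm)).elim
    · simp only [hx, hy, dite_true, dite_false]
      exact hval _ _ _ _ (hdom y (hx ▸ hxy.symm)).symm
    · simp only [hx, hy, dite_true, dite_false]
      exact hval _ _ _ _ (hdom x (hy ▸ hxy))
    · simp only [hx, hy, dite_false]
      exact hval _ _ _ _ hxy
  · refine hG.1 (hP5.map_embedding ⟨⟨Subtype.val, Subtype.val_injective⟩, fun {x y} => ?_⟩)
    exact ⟨fun h => ⟨x.2, y.2, h⟩, fun h => h.2.2⟩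

/-- An MN3P5 graph has no proper subgraph that is `P5`-free and not 3-colorable. -/
theorem IsMN3P5.nonempty_iso_of_containsSub (hG : IsMN3P5 G) (h : ContainsSub G H)
    (hP5 : P5Free H) (hcol : ¬ H.Colorable 3) : Nonempty (G ≃g H) := by
  obtain ⟨f, hf⟩ := h
  let S : G.Subgraph := (⊤ : H.Subgraph).map ⟨f, fun {a b} => hf a b⟩
  have hadj : ∀ a b, S.Adj (f a) (f b) ↔ H.Adj a b := fun a b => by
    simp [S, Relation.map_apply_apply f.injective f.injective]
  have hmem : ∀ a, f a ∈ S.verts := fun a => by simp [S]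
  have e : H ≃g S.coe := by
    refine ⟨Equiv.ofBijective (fun a => ⟨f a, hmem a⟩) ⟨fun a b hab => ?_, fun x => ?_⟩, ?_⟩
    · exact f.injective (congrArg Subtype.val hab)
    · obtain ⟨x, hx⟩ := x
      obtain ⟨a, -, rfl⟩ := hx
      exact ⟨a, rfl⟩
    · exact fun {a b} => hadj a b
  have hS : S = ⊤ := by
    by_contra hne
    rcases hG.2.2 S hne with h | h
    · exact hcol (h.of_hom e.toHom)
    · exact hP5 (h.map_embedding e.symm.toEmbedding)
  rw [hS] at e
  exact ⟨(e.trans Subgraph.topIso).symm⟩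

end Criticality

section Codes

/-! A finite graph on `{0, …, n - 1}` is encoded by the list of the bit masks of the sets
`{i < k | i adjacent to k}`, for `k = n - 1, …, 0`. -/

/-- Adjacency in the graph encoded by a list of masks. -/
def codeAdj : List ℕ → ℕ → ℕ → Bool
  | [], _, _ => false
  | m :: L, i, j =>
    if i = L.length then j < L.length && m.testBit j
    else if j = L.length then i < L.length && m.testBit i
    else codeAdj L i j

/-- The vertices `f 0, …, f (L.length - 1)` are distinct and induce the graph encoded by `L`. -/
def Realizes {V : Type*} (G : SimpleGraph V) (f : ℕ → V) : List ℕ → Prop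
  | [] => True
  | m :: L => Realizes G f L ∧
      ∀ i < L.length, f i ≠ f L.length ∧ (G.Adj (f i) (f L.length) ↔ m.testBit i = true)

/-- Quadruples `p, q, r, s` such that `x, p, q, r, s` is a 5-cycle with exactly one of the edges
`qr`, `rs`, `sx` missing, as soon as `x` is adjacent to `p`, not adjacent to `q` and `r`, and
adjacent to `s` exactly when the last component says so. -/
def pathQuads (L : List ℕ) : List (ℕ × ℕ × ℕ × ℕ × Bool) :=
  (List.range L.length).flatMap fun p =>
    ((List.range L.length).filter fun q => codeAdj L p q).flatMap fun q =>
      ((List.range L.length).filter fun r => !codeAdj L p r).flatMap fun r =>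
        ((List.range L.length).filter fun s => !codeAdj L p s && !codeAdj L q s &&
          (codeAdj L q r || codeAdj L r s)).map fun s =>
            (p, q, r, s, !(codeAdj L q r && codeAdj L r s))

/-- A vertex with neighborhood `N` closes an induced `P5` listed in `Q`. -/
def closesPath (Q : List (ℕ × ℕ × ℕ × ℕ × Bool)) (N : ℕ → Bool) : Bool :=
  Q.any fun (p, q, r, s, b) => N p && !N q && !N r && (N s == b)

/-- A vertex with neighborhood `x` forms a `K4` with a triangle of the graph encoded by `L`. -/
def closesClique (L : List ℕ) (x : ℕ) : Bool :=
  (List.range L.length).any fun p => x.testBit p &&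
    (List.range L.length).any fun q => x.testBit q && codeAdj L p q &&
      (List.range L.length).any fun r => x.testBit r && codeAdj L p r && codeAdj L q r

/-- The masks that can occur as the neighborhood of an additional vertex in a `P5`-free and
`K4`-free graph. -/
def extensions : List ℕ → List ℕ
  | [] => [0]
  | m :: L => ((extensions L).flatMap fun x => [x, x ||| 2 ^ L.length]).filter fun x =>
      !closesPath (pathQuads (m :: L)) x.testBit && !closesClique (m :: L) x

variable {V : Type*} {G : SimpleGraph V} {f g : ℕ → V} {L : List ℕ}

theorem Realizes.congr (h : Realizes G f L) (hfg : ∀ i < L.length, f i = g i) :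
    Realizes G g L := by
  induction L with
  | nil => trivial
  | cons m L ih =>
    refine ⟨ih h.1 fun i hi => hfg i (hi.trans (Nat.lt_succ_self _)), fun i hi => ?_⟩
    rw [← hfg i (hi.trans (Nat.lt_succ_self _)), ← hfg L.length (Nat.lt_succ_self _)]
    exact h.2 i hi

theorem Realizes.injOn (h : Realizes G f L) {i j : ℕ} (hi : i < L.length) (hj : j < L.length)
    (hij : f i = f j) : i = j := by
  induction L with
  | nil => simp at hi
  | cons m L ih =>
    rw [List.length_cons, Nat.lt_succ_iff_lt_or_eq] at hi hj
    rcases hi with hi | rfl <;> rcases hj with hj | rfl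
    · exact ih h.1 hi hj
    · exact ((h.2 i hi).1 hij).elim
    · exact ((h.2 j hj).1 hij.symm).elim
    · rfl

theorem Realizes.adj_iff (h : Realizes G f L) {i j : ℕ} (hi : i < L.length) (hj : j < L.length) :
    G.Adj (f i) (f j) ↔ codeAdj L i j = true := by
  induction L with
  | nil => simp at hi
  | cons m L ih =>
    rw [List.length_cons, Nat.lt_succ_iff_lt_or_eq] at hi hj
    rcases hi with hi | rfl <;> rcases hj with hj | rfl
    · rw [ih h.1 hi hj]
      simp [codeAdj, hi.ne, hj.ne]
    · simp [codeAdj, hi.ne, hi, (h.2 i hi).2]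
    · rw [G.adj_comm]
      simp [codeAdj, hj, (h.2 j hj).2]
    · simp [codeAdj]

theorem Realizes.not_closesPath (h : Realizes G f L) (hG : P5Free G) {x : ℕ} {y : V}
    (hx : ∀ i < L.length, x.testBit i = true ↔ G.Adj (f i) y) :
    closesPath (pathQuads L) x.testBit = false := by
  by_contra hc
  simp only [closesPath, pathQuads, Bool.not_eq_false, List.any_eq_true, List.mem_flatMap,
    List.mem_filter, List.mem_map, List.mem_range, Bool.and_eq_true, Bool.not_eq_true',
    Bool.or_eq_true, beq_iff_eq] at hc
  obtain ⟨_, ⟨p, hp, q, ⟨hq, hpq⟩, r, ⟨hr, hpr⟩, s, ⟨hs, ⟨hps, hqs⟩, hqrs⟩, rfl⟩,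
    ⟨⟨hxp, hxq⟩, hxr⟩, hxs⟩ := hc
  rw [← Bool.not_eq_true] at hpr hps hqs hxq hxr
  rw [← h.adj_iff hp hq] at hpq
  rw [← h.adj_iff hp hr] at hpr
  rw [← h.adj_iff hp hs] at hps
  rw [← h.adj_iff hq hs] at hqs
  rw [hx p hp] at hxp
  rw [hx q hq] at hxq
  rw [hx r hr] at hxr
  have hqr := h.adj_iff hq hr
  have hrs := h.adj_iff hr hs
  have hys := hx s hs
  rw [hxs] at hys
  cases hcqr : codeAdj L q r <;> cases hcrs : codeAdj L r s <;>
    simp [hcqr, hcrs] at hqr hrs hys hqrs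
  · exact hG (.of_adj hpq.symm hxp hys.symm hrs.symm hxq hqs hqr hps
      hpr (mt .symm hxr))
  · exact hG (.of_adj hys hxp.symm hpq hqr (mt .symm hps) (mt .symm hqs) (mt .symm hrs)
      (mt .symm hxq) (mt .symm hxr) hpr)
  · exact hG (.of_adj hxp.symm hpq hqr hrs (mt .symm hxq) (mt .symm hxr) (mt .symm hys)
      hpr hps hqs)

theorem Realizes.not_closesClique (h : Realizes G f L) (hG : G.CliqueFree 4) {x : ℕ} {y : V}
    (hx : ∀ i < L.length, x.testBit i = true ↔ G.Adj (f i) y) :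
    closesClique L x = false := by
  by_contra hc
  simp only [closesClique, Bool.not_eq_false, List.any_eq_true, List.mem_range,
    Bool.and_eq_true] at hc
  obtain ⟨p, hp, hxp, q, hq, ⟨hxq, hpq⟩, r, hr, ⟨hxr, hpr⟩, hqr⟩ := hc
  rw [← h.adj_iff hp hq] at hpq
  rw [← h.adj_iff hp hr] at hpr
  rw [← h.adj_iff hq hr] at hqr
  rw [hx p hp] at hxp
  rw [hx q hq] at hxq
  rw [hx r hr] at hxr
  classical
  exact hG _ (by
    have h3 := is3Clique_triple_iff.2 ⟨hpq, hpr, hqr⟩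
    exact h3.insert (a := y) fun z hz => by
      simp only [Finset.mem_insert, Finset.mem_singleton] at hz
      rcases hz with rfl | rfl | rfl <;> exact G.adj_symm ‹_›)

theorem Realizes.exists_mem_extensions (h : Realizes G f L) (hP5 : P5Free G)
    (hK4 : G.CliqueFree 4) (y : V) :
    ∃ x ∈ extensions L, ∀ i, x.testBit i = true ↔ i < L.length ∧ G.Adj (f i) y := by
  classical
  induction L with
  | nil => exact ⟨0, by simp [extensions]⟩
  | cons m L ih =>
    obtain ⟨x, hxL, hx⟩ := ih h.1
    let x' := if G.Adj (f L.length) y then x ||| 2 ^ L.length else x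
    have hx' : ∀ i, x'.testBit i = true ↔ i < (m :: L).length ∧ G.Adj (f i) y := fun i => by
      by_cases hy : G.Adj (f L.length) y <;>
        simp only [x', hy, if_true, if_false, Nat.testBit_or, Nat.testBit_two_pow, Bool.or_eq_true,
          decide_eq_true_eq, hx, List.length_cons, Nat.lt_succ_iff_lt_or_eq] <;> grind
    refine ⟨x', ?_, hx'⟩
    simp only [extensions, List.mem_filter, List.mem_flatMap, List.mem_cons, List.not_mem_nil,
      or_false, Bool.and_eq_true, Bool.not_eq_true']
    refine ⟨⟨x, hxL, by grind⟩, h.not_closesPath hP5 (y := y) fun i hi => by grind,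
      h.not_closesClique hK4 (y := y) fun i hi => by grind⟩

theorem Realizes.exists_extension (h : Realizes G f L) (hP5 : P5Free G) (hK4 : G.CliqueFree 4)
    {y : V} (hy : ∀ i < L.length, f i ≠ y) :
    ∃ x ∈ extensions L, (∀ i < L.length, x.testBit i = true ↔ G.Adj (f i) y) ∧
      Realizes G (Function.update f L.length y) (x :: L) := by
  obtain ⟨x, hxL, hx⟩ := h.exists_mem_extensions hP5 hK4 y
  refine ⟨x, hxL, fun i hi => by simp [hx, hi], h.congr fun i hi => by simp [hi.ne],
    fun i hi => by simp [hi.ne, hy i hi, hx, hi]⟩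

end Codes

section Six

/-- All proper 3-colorings of the graph encoded by a list of masks. -/
def codeColorings : List ℕ → List (ℕ → Fin 3)
  | [] => [fun _ => 0]
  | m :: L => (codeColorings L).flatMap fun c =>
      ([0, 1, 2].filter fun k => (List.range L.length).all fun i =>
        !m.testBit i || decide (c i ≠ k)).map (Function.update c L.length)

theorem Realizes.exists_mem_codeColorings {V : Type*} {G : SimpleGraph V} {f : ℕ → V}
    {L : List ℕ} (h : Realizes G f L) (C : G.Coloring (Fin 3)) :
    ∃ c ∈ codeColorings L, ∀ i < L.length, c i = C (f i) := by
  induction L with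
  | nil => exact ⟨fun _ => 0, by simp [codeColorings]⟩
  | cons m L ih =>
    obtain ⟨c, hcL, hc⟩ := ih h.1
    refine ⟨Function.update c L.length (C (f L.length)), ?_, fun i hi => ?_⟩
    · simp only [codeColorings, List.mem_flatMap, List.mem_map, List.mem_filter, List.all_eq_true,
        List.mem_range]
      refine ⟨c, hcL, _, ⟨?_, fun i hi => ?_⟩, rfl⟩
      · generalize C (f L.length) = k
        revert k
        decide
      · cases hm : m.testBit i
        · rfl
        · simpa [hc i hi] using C.valid ((h.2 i hi).2.2 hm)
    · rw [List.length_cons, Nat.lt_succ_iff_lt_or_eq] at hi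
      rcases hi with hi | rfl
      · simp [hi.ne, hc i hi]
      · simp

/-- The graph encoded by a list of masks is `P5`-free. -/
def codeP5Free (L : List ℕ) : Bool :=
  (List.range L.length).all fun x => !closesPath (pathQuads L) (codeAdj L x)

/-- The vertices listed in `e` span a graph containing the graph encoded by `P`. -/
def codeEmbeds (L P e : List ℕ) : Bool :=
  decide e.Nodup && (e.all fun k => decide (k < L.length)) && decide (P.length ≤ e.length) &&
    (List.range P.length).all fun i => (List.range P.length).all fun j =>
      !codeAdj P i j || codeAdj L (e.getD i 0) (e.getD j 0)

/-- `L` encodes `H` up to isomorphism. -/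
def Encodes {W : Type*} (L : List ℕ) (H : SimpleGraph W) : Prop :=
  ∃ f : ℕ → W, Realizes H f L ∧ ∀ v, ∃ i < L.length, f i = v

variable {V W : Type*} {G : SimpleGraph V} {H : SimpleGraph W} {f : ℕ → V} {L P e : List ℕ}

theorem Encodes.p5Free (h : Encodes P H) (hP : codeP5Free P = true) : P5Free H := by
  rintro ⟨g, hg⟩
  obtain ⟨f, hf, hsurj⟩ := h
  choose k hk hfk using hsurj
  have hadj : ∀ i j, codeAdj P (k (g i)) (k (g j)) = true ↔ (pathGraph 5).Adj i j := fun i j => by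
    rw [← hf.adj_iff (hk _) (hk _), hfk, hfk, hg]
  have hadj' : ∀ i j, codeAdj P (k (g i)) (k (g j)) = false ↔ ¬ (pathGraph 5).Adj i j :=
    fun i j => by rw [← hadj, Bool.not_eq_true]
  simp only [codeP5Free, List.all_eq_true, List.mem_range, Bool.not_eq_true',
    ← Bool.not_eq_true] at hP
  refine hP _ (hk (g 0)) ?_
  simp only [closesPath, List.any_eq_true]
  refine ⟨(k (g 1), k (g 2), k (g 3), k (g 4), false), ?_, ?_⟩
  · simp only [pathQuads, List.mem_flatMap, List.mem_filter, List.mem_map, List.mem_range]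
    refine ⟨_, hk (g 1), _, ⟨hk (g 2), ?_⟩, _, ⟨hk (g 3), ?_⟩, _, ⟨hk (g 4), ?_⟩, ?_⟩ <;>
      simp [hadj, hadj', pathGraph_adj]
  · simp [hadj, hadj', pathGraph_adj]

theorem Encodes.not_colorable (h : Encodes P H) (hP : (codeColorings P).isEmpty = true) :
    ¬ H.Colorable 3 := by
  rintro ⟨C⟩
  obtain ⟨f, hf, -⟩ := h
  obtain ⟨c, hc, -⟩ := hf.exists_mem_codeColorings C
  rw [List.isEmpty_iff.1 hP] at hc
  simp at hc

theorem Encodes.containsSub (h : Encodes P H) (hf : Realizes G f L)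
    (he : codeEmbeds L P e = true) : ContainsSub G H := by
  obtain ⟨g, hg, hsurj⟩ := h
  choose k hk hgk using hsurj
  simp only [codeEmbeds, Bool.and_eq_true, decide_eq_true_eq, List.all_eq_true, List.mem_range,
    Bool.or_eq_true, Bool.not_eq_true'] at he
  obtain ⟨⟨⟨hnodup, hlt⟩, hlen⟩, hedge⟩ := he
  have hke : ∀ w, k w < e.length := fun w => (hk w).trans_le hlen
  have hlt' : ∀ w, e.getD (k w) 0 < L.length := fun w => by
    rw [List.getD_eq_getElem _ _ (hke w)]
    exact hlt _ (List.getElem_mem _)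
  refine ⟨⟨fun w => f (e.getD (k w) 0), fun v w hvw => ?_⟩, fun v w hvw => ?_⟩
  · have := hf.injOn (hlt' v) (hlt' w) hvw
    rw [List.getD_eq_getElem _ _ (hke v), List.getD_eq_getElem _ _ (hke w),
      hnodup.getElem_inj_iff] at this
    rw [← hgk v, ← hgk w, this]
  · rw [← hgk v, ← hgk w, hg.adj_iff (hk v) (hk w)] at hvw
    refine (hf.adj_iff (hlt' v) (hlt' w)).2 ((hedge _ (hk v) _ (hk w)).resolve_left ?_)
    simp [hvw]

instance Realizes.instDecidable [DecidableEq V] [DecidableRel G.Adj] :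
    ∀ L, Decidable (Realizes G f L)
  | [] => .isTrue trivial
  | _ :: L => @instDecidableAnd _ _ (instDecidable L) _

theorem Encodes.of_realizes {n : ℕ} {H : SimpleGraph (Fin (n + 1))} (hL : L.length = n + 1)
    (h : Realizes H (Fin.ofNat (n + 1)) L) : Encodes L H :=
  ⟨_, h, fun v => ⟨v, by rw [hL]; exact v.2, by simp⟩⟩

instance {n : ℕ} (l : List (Fin n × Fin n)) : DecidableRel (graphOfList l).Adj :=
  inferInstanceAs (DecidableRel (SimpleGraph.fromRel fun a b => (a, b) ∈ l).Adj)

/-- Encodings of the graphs `W5`, `S1`, `S2`, `T` and `B`. -/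
def sixCodes : List (List ℕ) :=
  [[31, 9, 4, 2, 1, 0],
   [25, 7, 9, 4, 2, 1, 0],
   [13, 30, 9, 4, 2, 1, 0],
   [458, 53, 105, 52, 18, 9, 6, 3, 1, 0],
   [3235, 376, 440, 441, 131, 68, 51, 4, 6, 7, 3, 0, 0]]

theorem encodes_graphW5 : Encodes [31, 9, 4, 2, 1, 0] graphW5 :=
  .of_realizes rfl (by unfold graphW5; decide +kernel)

theorem encodes_graphS1 : Encodes [25, 7, 9, 4, 2, 1, 0] graphS1 :=
  .of_realizes rfl (by unfold graphS1; decide +kernel)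

theorem encodes_graphS2 : Encodes [13, 30, 9, 4, 2, 1, 0] graphS2 :=
  .of_realizes rfl (by unfold graphS2; decide +kernel)

theorem encodes_graphT : Encodes [458, 53, 105, 52, 18, 9, 6, 3, 1, 0] graphT :=
  .of_realizes rfl (by unfold graphT; decide +kernel)

theorem encodes_graphB :
    Encodes [3235, 376, 440, 441, 131, 68, 51, 4, 6, 7, 3, 0, 0] graphB :=
  .of_realizes rfl (by unfold graphB; decide +kernel)

theorem IsMN3P5.isoToSix_of_codeEmbeds (hG : IsMN3P5 G) (hf : Realizes G f L) {k : ℕ}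
    (he : sixCodes[k]?.any (codeEmbeds L · e) = true) : IsoToSix G := by
  have hiso : ∀ {W : Type} {H : SimpleGraph W} {P : List ℕ}, Encodes P H → P ∈ sixCodes →
      codeEmbeds L P e = true → Nonempty (G ≃g H) := fun h hP he =>
    have hcheck : ∀ P ∈ sixCodes, codeP5Free P = true ∧ (codeColorings P).isEmpty = true := by
      decide +kernel
    hG.nonempty_iso_of_containsSub (h.containsSub hf he) (h.p5Free (hcheck _ hP).1)
      (h.not_colorable (hcheck _ hP).2)
  obtain ⟨P, hP, he⟩ := (Option.any_eq_true _ _).1 he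
  have hP := List.mem_of_getElem? hP
  have hmem := hP
  simp only [sixCodes, List.mem_cons, List.not_mem_nil, or_false] at hP
  rcases hP with rfl | rfl | rfl | rfl | rfl
  · exact .inr (.inl (hiso encodes_graphW5 hmem he))
  · exact .inr (.inr (.inl (hiso encodes_graphS1 hmem he)))
  · exact .inr (.inr (.inr (.inl (hiso encodes_graphS2 hmem he))))
  · exact .inr (.inr (.inr (.inr (.inl (hiso encodes_graphT hmem he)))))
  · exact .inr (.inr (.inr (.inr (.inr (hiso encodes_graphB hmem he)))))

theorem IsMN3P5.cliqueFree_four (hG : IsMN3P5 G) (hn : ¬ IsoToSix G) : G.CliqueFree 4 := by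
  by_contra h
  obtain ⟨g⟩ := (not_cliqueFree_iff_top_isContained _).1 h
  refine hn (.inl (hG.nonempty_iso_of_containsSub ⟨g.toEmbedding, fun a b hab => ?_⟩ ?_ ?_))
  · exact g.toHom.map_adj hab
  · rintro ⟨f, -⟩
    simpa using Fintype.card_le_of_injective f f.injective
  · rintro ⟨C⟩
    have hC : Function.Injective C := fun a b hab =>
      by_contra fun hne => C.valid (show graphK4.Adj a b from hne) hab
    simpa using Fintype.card_le_of_injective C hC

end Six

section Search

/-- `G` has an induced subgraph encoded by `L` in which the first three vertices dominate `G`. -/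
def HasDominatedCode {V : Type*} (G : SimpleGraph V) (L : List ℕ) : Prop :=
  ∃ f : ℕ → V, Realizes G f L ∧ ∀ y, y ≠ f 0 → y ≠ f 1 → y ≠ f 2 →
    (G.Adj y (f 0) ∨ G.Adj y (f 1) ∨ G.Adj y (f 2))

/-- In the graph encoded by `L` all neighbors of `u` are neighbors of `w`, and every vertex
adjacent to `u` and not to `w` either has its mask in `S` or leads to one of the subgraphs
described by `certs`. -/
def coversExtensions (L : List ℕ) (u w : ℕ) (S : List ℕ) (certs : List (ℕ × List ℕ)) : Bool :=
  decide (2 < L.length ∧ u < L.length ∧ w < L.length ∧ u ≠ w) && !codeAdj L u w &&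
  ((List.range L.length).all fun k => !codeAdj L k u || codeAdj L k w) &&
  (extensions L).all fun x =>
    !(x.testBit u && !x.testBit w && (x.testBit 0 || x.testBit 1 || x.testBit 2)) ||
    S.contains x || certs.any fun c => sixCodes[c.1]?.any (codeEmbeds (x :: L) · c.2)

variable {V : Type*} {G : SimpleGraph V}

theorem IsMN3P5.not_hasDominatedCode (hG : IsMN3P5 G) (hn : ¬ IsoToSix G) {L : List ℕ}
    (u w : ℕ) (S : List ℕ) (certs : List (ℕ × List ℕ))
    (hL : coversExtensions L u w S certs = true) (hS : ∀ x ∈ S, ¬ HasDominatedCode G (x :: L)) :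
    ¬ HasDominatedCode G L := by
  rintro ⟨f, hf, hdom⟩
  simp only [coversExtensions, Bool.and_eq_true, decide_eq_true_eq, Bool.or_eq_true,
    List.all_eq_true, List.mem_range, Bool.not_eq_true', List.any_eq_true,
    List.contains_iff_mem] at hL
  obtain ⟨⟨⟨⟨hlen, hu, hw, huw⟩, hadj⟩, hnbr⟩, hext⟩ := hL
  obtain ⟨y, hyu, hyw⟩ := hG.exists_adj_not_adj (u := f u) (w := f w)
    fun h => huw (hf.injOn hu hw h)
  have hy : ∀ i < L.length, f i ≠ y := by
    rintro i hi rfl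
    rw [hf.adj_iff hi hu] at hyu
    rw [hf.adj_iff hi hw] at hyw
    exact (hnbr i hi).elim (fun h => by simp [h] at hyu) hyw
  obtain ⟨x, hxL, hx, hxf⟩ := hf.exists_extension hG.1 (hG.cliqueFree_four hn) hy
  rcases hext x hxL with (hbits | hxS) | ⟨c, -, hc⟩
  · rw [← Bool.not_eq_true] at hbits
    refine hbits ?_
    simp only [Bool.and_eq_true, Bool.or_eq_true, Bool.not_eq_true', ← Bool.not_eq_true,
      hx u hu, hx w hw, hx 0 (by omega), hx 1 (by omega), hx 2 hlen, G.adj_comm _ y, or_assoc]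
    exact ⟨⟨hyu, hyw⟩, hdom y (hy 0 (by omega)).symm (hy 1 (by omega)).symm (hy 2 hlen).symm⟩
  · refine hS x hxS ⟨_, hxf, ?_⟩
    have h0 : 0 ≠ L.length := by omega
    have h1 : 1 ≠ L.length := by omega
    simpa [h0, h1, hlen.ne] using hdom
  · exact hn (hG.isoToSix_of_codeEmbeds hxf hc)

/-- No dominating triangle `0 1 2` admits vertices `3` adjacent to `0` and `1` only, and `4`
adjacent to `3` and to `0` but not to `1` and `2`. -/
theorem IsMN3P5.not_hasDominatedCode_diamond_path (hG : IsMN3P5 G) (hn : ¬ IsoToSix G) :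
    ¬ HasDominatedCode G [9, 3, 3, 1, 0] := by
  refine hG.not_hasDominatedCode hn 4 1 [20, 28]
      [(0, [1, 2, 5, 4, 3, 0])]
      (by decide +kernel) ?_
  rw [List.forall_mem_cons, List.forall_mem_singleton]
  constructor
  · exact hG.not_hasDominatedCode hn 5 0 []
        [(1, [1, 0, 4, 5, 2, 3, 6]),
         (2, [5, 4, 0, 1, 6, 3, 2]),
         (1, [2, 0, 3, 4, 5, 1, 6]),
         (1, [3, 0, 2, 5, 4, 1, 6]),
         (0, [1, 2, 5, 4, 3, 6])]
        (by decide +kernel) (by simp)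
  · refine hG.not_hasDominatedCode hn 2 3 [20, 22]
        [(0, [1, 2, 6, 4, 3, 0]),
         (1, [0, 1, 6, 5, 3, 2, 4]),
         (1, [2, 0, 3, 4, 5, 1, 6])]
        (by decide +kernel) ?_
    rw [List.forall_mem_cons, List.forall_mem_singleton]
    constructor
    · exact hG.not_hasDominatedCode hn 6 0 []
          [(1, [2, 0, 3, 4, 6, 1, 7]),
           (1, [3, 0, 2, 6, 4, 1, 7]),
           (0, [1, 2, 6, 4, 3, 7]),
           (0, [0, 1, 7, 5, 4, 3])]
          (by decide +kernel) (by simp)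
    · refine hG.not_hasDominatedCode hn 6 0 [76]
          [(0, [0, 2, 6, 7, 3, 1]),
           (1, [0, 1, 6, 7, 3, 2, 4])]
          (by decide +kernel) ?_
      rw [List.forall_mem_singleton]
      refine hG.not_hasDominatedCode hn 5 0 [178]
          [(0, [0, 2, 6, 8, 3, 1]),
           (1, [0, 1, 8, 5, 3, 2, 4])]
          (by decide +kernel) ?_
      rw [List.forall_mem_singleton]
      refine hG.not_hasDominatedCode hn 7 1 [225]
          [(1, [0, 1, 6, 7, 3, 2, 9]),
           (0, [1, 2, 9, 4, 3, 0]),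
           (3, [0, 2, 1, 6, 4, 5, 8, 9, 3, 7])]
          (by decide +kernel) ?_
      rw [List.forall_mem_singleton]
      refine hG.not_hasDominatedCode hn 8 3 [353]
          [(3, [0, 2, 1, 6, 4, 5, 8, 10, 3, 7]),
           (1, [0, 1, 8, 5, 3, 10, 4])]
          (by decide +kernel) ?_
      rw [List.forall_mem_singleton]
      refine hG.not_hasDominatedCode hn 9 2 [1682]
          [(3, [0, 2, 1, 6, 4, 5, 11, 9, 3, 7]),
           (1, [0, 1, 6, 7, 9, 2, 11])]
          (by decide +kernel) ?_
      rw [List.forall_mem_singleton]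
      exact hG.not_hasDominatedCode hn 10 4 []
          [(4, [0, 6, 2, 1, 7, 12, 9, 5, 4, 3, 8, 11, 10]),
           (3, [0, 2, 1, 6, 4, 5, 8, 10, 3, 12]),
           (1, [0, 3, 5, 8, 10, 4, 12])]
          (by decide +kernel) (by simp)

theorem HasDominatedCode.swap (h : HasDominatedCode G [10, 3, 3, 1, 0]) :
    HasDominatedCode G [9, 3, 3, 1, 0] := by
  obtain ⟨f, hf, hdom⟩ := h
  refine ⟨f ∘ Equiv.swap 0 1, ?_, fun y h0 h1 h2 => ?_⟩
  · refine ⟨⟨⟨⟨⟨trivial, ?_⟩, ?_⟩, ?_⟩, ?_⟩, ?_⟩ <;> intro i hi <;> simp only [List.length] at hi <;>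
      interval_cases i <;>
      exact ⟨mt (hf.injOn (by decide) (by decide)) (by decide),
        (hf.adj_iff (by decide) (by decide)).trans (by decide)⟩
  · have := hdom y h1 h0 h2
    exact or_left_comm.1 this

/-- No dominating triangle `0 1 2` admits a vertex adjacent to `0` and `1` only. -/
theorem IsMN3P5.not_hasDominatedCode_diamond (hG : IsMN3P5 G) (hn : ¬ IsoToSix G) :
    ¬ HasDominatedCode G [3, 3, 1, 0] := by
  refine hG.not_hasDominatedCode hn 3 2 [9, 10] [] (by decide +kernel) ?_
  rw [List.forall_mem_cons, List.forall_mem_singleton]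
  exact ⟨hG.not_hasDominatedCode_diamond_path hn,
    fun h => hG.not_hasDominatedCode_diamond_path hn h.swap⟩

theorem IsDomClique3.isoToSix {a b c v : V} (h : IsDomClique3 G a b c) (hG : IsMN3P5 G)
    (hvc : v ≠ c) (hva : G.Adj v a) (hvb : G.Adj v b) : IsoToSix G := by
  by_contra hn
  obtain ⟨-, -, -, hab, hac, hbc, hdom⟩ := h
  have hvc' : ¬ G.Adj c v := fun hcv => by
    have hK4 := hG.cliqueFree_four hn
    classical
    refine hK4 _ ((is3Clique_triple_iff.2 ⟨hab, hac, hbc⟩).insert (a := v) fun z hz => ?_)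
    simp only [Finset.mem_insert, Finset.mem_singleton] at hz
    rcases hz with rfl | rfl | rfl
    exacts [hva, hvb, hcv.symm]
  refine hG.not_hasDominatedCode_diamond hn
    ⟨fun i => if i = 0 then a else if i = 1 then b else if i = 2 then c else v, ?_, hdom⟩
  refine ⟨⟨⟨⟨trivial, ?_⟩, ?_⟩, ?_⟩, ?_⟩ <;> intro i hi <;> simp only [List.length] at hi <;>
    interval_cases i <;>
    simp [hab, hac, hbc, hva.symm, hvb.symm, hvc', hvc.symm, hab.ne, hac.ne, hbc.ne, hva.ne',
      hvb.ne', Nat.testBit_succ]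

end Search

theorem mn3p5_dom_clique3_vertex_two_neighbors
    {V : Type*} [Fintype V] (G : SimpleGraph V) (hG : IsMN3P5 G)
    (a b c : V) (hdom : IsDomClique3 G a b c)
    (v : V) (hv : v ≠ a ∧ v ≠ b ∧ v ≠ c)
    (h2 : (G.Adj v a ∧ G.Adj v b) ∨ (G.Adj v a ∧ G.Adj v c) ∨ (G.Adj v b ∧ G.Adj v c)) :
    IsoToSix G := by
  obtain ⟨hab, hac, hbc, gab, gac, gbc, hdom⟩ := hdom
  rcases h2 with ⟨h, h'⟩ | ⟨h, h'⟩ | ⟨h, h'⟩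
  · exact IsDomClique3.isoToSix ⟨hab, hac, hbc, gab, gac, gbc, hdom⟩ hG hv.2.2 h h'
  · exact IsDomClique3.isoToSix (b := c) (c := b) ⟨hac, hab, hbc.symm, gac, gab, gbc.symm,
      fun x ha hc hb => by have := hdom x ha hb hc; tauto⟩ hG hv.2.1 h h'
  · exact IsDomClique3.isoToSix (a := b) (b := c) (c := a) ⟨hbc, hab.symm, hac.symm, gbc, gab.symm,
      gac.symm, fun x hb hc ha => by have := hdom x ha hb hc; tauto⟩ hG hv.1 h h'
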